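/- arXiv:1607.06173 — 3 statements merged into one kernel-verified Lean document; each statement's English description precedes it below -/
import Mathlib

section
/- For every a ∈ ℝⁿ and every β with 0 < β < 1, the union ⋃_{k=0}^∞ Q_k is contained in P_a. -/
open MeasureTheory

/-- The cross-polytope (closed `L¹`-ball) of radius `r` centered at `c` in `ℝⁿ`. -/
def crossPolytope {n : ℕ} (c : Fin n → ℝ) (r : ℝ) : Set (Fin n → ℝ) :=
  {x | ∑ i, |x i - c i| ≤ r}

/-- The knapsack dual polytope `P_a = conv{±e₁, …, ±eₙ, a}`. -/
def knapsackDual {n : ℕ} (a : Fin n → ℝ) : Set (Fin n → ℝ) :=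
  convexHull ℝ (({a} : Set (Fin n → ℝ)) ∪
    ⋃ i : Fin n, ({Pi.single i (1 : ℝ), -Pi.single i (1 : ℝ)} : Set (Fin n → ℝ)))

theorem l1_mem_aux {n : ℕ} (hn : 1 ≤ n) (a y : Fin n → ℝ) (hy : ∑ i, |y i| ≤ 1) :
    y ∈ knapsackDual a := by
  have hc : Convex ℝ (knapsackDual a) := convex_convexHull ℝ _
  have hp : ∀ i, (Pi.single i (1 : ℝ) : Fin n → ℝ) ∈ knapsackDual a := fun i =>
    subset_convexHull ℝ _ (Or.inr (Set.mem_iUnion.2 ⟨i, Or.inl rfl⟩))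
  have hm : ∀ i, -(Pi.single i (1 : ℝ) : Fin n → ℝ) ∈ knapsackDual a := fun i =>
    subset_convexHull ℝ _ (Or.inr (Set.mem_iUnion.2 ⟨i, Or.inr rfl⟩))
  have h0 : (0 : Fin n → ℝ) ∈ knapsackDual a := by
    have h := hc (hp ⟨0, hn⟩) (hm ⟨0, hn⟩) (a := 1 / 2) (b := 1 / 2)
      (by norm_num) (by norm_num) (by norm_num)
    simpa using h
  let w : Option (Fin n) → ℝ := fun o => o.elim (1 - ∑ i, |y i|) (fun i => |y i|)
  let z : Option (Fin n) → (Fin n → ℝ) := fun o => o.elim 0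
    (fun i => if 0 ≤ y i then Pi.single i (1 : ℝ) else -Pi.single i (1 : ℝ))
  have h := hc.sum_mem (t := Finset.univ) (w := w) (z := z) ?_ ?_ ?_
  · convert h using 1
    rw [Fintype.sum_option]
    have : ∀ i, w (some i) • z (some i) = Pi.single i (y i) := by
      intro i
      simp only [w, z, Option.elim]
      ext j
      by_cases hij : j = i
      · subst hij
        split_ifs with h
        · simp [abs_of_nonneg h]
        · simp [abs_of_neg (not_le.1 h)]
      · split_ifs <;> simp [hij]
    simp only [this]
    simp [z, Finset.univ_sum_single]
  · rintro (_ | i) _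
    · simpa [w] using hy
    · simp [w]
  · rw [Fintype.sum_option]; simp [w]
  · rintro (_ | i) _
    · exact h0
    · simp only [z, Option.elim]
      split_ifs
      · exact hp i
      · exact hm i

theorem stmt1 (n : ℕ) (hn : 1 ≤ n) (a : Fin n → ℝ)
    (β : ℝ) (hβ0 : 0 < β) (hβ1 : β < 1) :
    (⋃ k : ℕ, crossPolytope ((1 - β ^ k) • a) (β ^ k)) ⊆ knapsackDual a := by
  rintro x hx
  obtain ⟨k, hk⟩ := Set.mem_iUnion.1 hx
  have hk : ∑ i, |x i - ((1 - β ^ k) • a) i| ≤ β ^ k := hk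
  have hb : 0 < β ^ k := pow_pos hβ0 k
  have hb1 : β ^ k ≤ 1 := pow_le_one₀ hβ0.le hβ1.le
  generalize β ^ k = b at hk hb hb1
  have hy := l1_mem_aux hn a (b⁻¹ • (x - (1 - b) • a)) (by
    simp only [Pi.smul_apply, Pi.sub_apply, smul_eq_mul, abs_mul, abs_of_pos (inv_pos.2 hb)] at hk ⊢
    rw [← Finset.mul_sum, inv_mul_le_iff₀ hb]
    simpa using hk)
  have ha : a ∈ knapsackDual a := subset_convexHull ℝ _ (Or.inl rfl)
  have hc : Convex ℝ (knapsackDual a) := convex_convexHull ℝ _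
  have h := hc ha hy (sub_nonneg.2 hb1) hb.le (by ring)
  rw [smul_inv_smul₀ hb.ne'] at h
  simpa using h
end

section
/- Let n ≥ 1, let r > 0, let c = (c_1, c_2, …, c_n) ∈ ℝⁿ have all entries nonnegative, and let c' = (c_1, 0, …, 0) be obtained from c by replacing each coordinate except the first with 0. Then Vol(C(0,1) ∩ C(c,r)) ≤ Vol(C(0,1) ∩ C(c',r)). -/
open MeasureTheory

lemma cp_closed {n : ℕ} (c : Fin n → ℝ) (r : ℝ) : IsClosed (crossPolytope c r) := by
  unfold crossPolytope
  exact isClosed_le (by fun_prop) continuous_const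

lemma cp_slice (a b c : ℝ) :
    volume {t : ℝ | |t| ≤ a ∧ |t - c| ≤ b} ≤ volume {t : ℝ | |t| ≤ a ∧ |t| ≤ b} := by
  have h2 : {t : ℝ | |t| ≤ a ∧ |t| ≤ b} = Set.Icc (-(min a b)) (min a b) := by
    ext t
    simp only [Set.mem_ofPred_eq, Set.mem_Icc]
    rw [← abs_le, le_min_iff]
  rw [h2, Real.volume_Icc]
  rcases le_total a b with h | h
  · rw [min_eq_left h, ← Real.volume_Icc]
    exact measure_mono fun t ht => abs_le.1 ht.1
  · rw [min_eq_right h]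
    calc _ ≤ volume (Set.Icc (c - b) (c + b)) := by
          refine measure_mono fun t ht => ?_
          have := abs_le.1 ht.2
          constructor <;> linarith
      _ = _ := by rw [Real.volume_Icc]; congr 1; ring

lemma cp_step {m : ℕ} (c : Fin (m+1) → ℝ) (r : ℝ) (i : Fin (m+1)) :
    volume (crossPolytope (0 : Fin (m+1) → ℝ) 1 ∩ crossPolytope c r) ≤
    volume (crossPolytope (0 : Fin (m+1) → ℝ) 1 ∩ crossPolytope (Function.update c i 0) r) := by
  have mp := (volume_preserving_piFinSuccAbove (fun _ : Fin (m+1) => ℝ) i).symm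
  have hm : ∀ d : Fin (m+1) → ℝ,
      MeasurableSet (crossPolytope (0 : Fin (m+1) → ℝ) 1 ∩ crossPolytope d r) := fun d =>
    ((cp_closed _ _).inter (cp_closed _ _)).measurableSet
  rw [← mp.measure_preimage (hm c).nullMeasurableSet,
    ← mp.measure_preimage (hm _).nullMeasurableSet, Measure.volume_eq_prod,
    Measure.prod_apply_symm (mp.measurable (hm _)), Measure.prod_apply_symm (mp.measurable (hm _))]
  refine lintegral_mono fun y => ?_
  have key : ∀ d : Fin (m+1) → ℝ, ((fun x : ℝ => (x, y)) ⁻¹'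
      ((MeasurableEquiv.piFinSuccAbove (fun _ : Fin (m+1) => ℝ) i).symm ⁻¹'
      (crossPolytope (0 : Fin (m+1) → ℝ) 1 ∩ crossPolytope d r))) =
      {t : ℝ | |t| ≤ 1 - ∑ j, |y j| ∧ |t - d i| ≤ r - ∑ j, |y j - d (i.succAbove j)|} := by
    intro d
    ext t
    have e : (MeasurableEquiv.piFinSuccAbove (fun _ : Fin (m+1) => ℝ) i).symm (t, y)
        = i.insertNth t y := rfl
    simp [crossPolytope, e, Fin.sum_univ_succAbove _ i,
      le_sub_iff_add_le]
  simp only [key]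
  simpa using cp_slice (1 - ∑ j, |y j|) (r - ∑ j, |y j - c (i.succAbove j)|) (c i)

lemma cp_fin {n : ℕ} : volume (crossPolytope (0 : Fin n → ℝ) 1) ≠ ⊤ := by
  refine ne_top_of_le_ne_top (isCompact_Icc (a := fun _ : Fin n => (-1:ℝ))
    (b := fun _ => 1)).measure_lt_top.ne (measure_mono fun x hx => ?_)
  have h : ∀ i, |x i| ≤ 1 := fun i => by
    have hx' : ∑ i, |x i| ≤ 1 := by simpa [crossPolytope] using hx
    exact (Finset.single_le_sum (f := fun i => |x i|) (fun j _ => abs_nonneg _)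
      (Finset.mem_univ i)).trans hx'
  exact ⟨fun i => (abs_le.1 (h i)).1, fun i => (abs_le.1 (h i)).2⟩

lemma cp_ind {m : ℕ} (c : Fin (m+1) → ℝ) (r : ℝ) (s : Finset (Fin (m+1))) :
    volume (crossPolytope (0 : Fin (m+1) → ℝ) 1 ∩ crossPolytope c r) ≤
    volume (crossPolytope (0 : Fin (m+1) → ℝ) 1 ∩
      crossPolytope (fun j => if j ∈ s then 0 else c j) r) := by
  induction s using Finset.induction_on with
  | empty => simp
  | insert i s hi ih =>
    refine ih.trans ((cp_step _ r i).trans (le_of_eq ?_))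
    congr 3
    ext j
    by_cases h : j = i
    · subst h; simp
    · simp [h]

theorem stmt8 (n : ℕ) (hn : 0 < n) (r : ℝ) (hr : 0 < r)
    (c : Fin n → ℝ) (hcnn : ∀ i, 0 ≤ c i) :
    (volume (crossPolytope (0 : Fin n → ℝ) 1 ∩ crossPolytope c r)).toReal
      ≤ (volume (crossPolytope (0 : Fin n → ℝ) 1 ∩
          crossPolytope (Pi.single (⟨0, hn⟩ : Fin n) (c ⟨0, hn⟩)) r)).toReal := by
  refine ENNReal.toReal_mono (measure_ne_top_of_subset Set.inter_subset_left cp_fin) ?_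
  obtain ⟨m, rfl⟩ : ∃ m, n = m + 1 := ⟨n - 1, by omega⟩
  refine (cp_ind c r (Finset.univ.erase ⟨0, hn⟩)).trans (le_of_eq ?_)
  congr 3
  ext j
  by_cases h : j = ⟨0, hn⟩
  · subst h; simp
  · rw [Pi.single_eq_of_ne h]
    exact if_pos (Finset.mem_erase.2 ⟨h, Finset.mem_univ _⟩)
end

section
/- Let n ≥ 1 and let a ∈ ℤⁿ satisfy a_1 ≥ a_2 ≥ ⋯ ≥ a_n ≥ 0 and a_1 ≥ 1. Let 0 < ε < 1 and let 0 < β < 1 satisfy 1 − β ≥ ε/(n·‖a‖₁). Then Vol(Q_0 ∩ Q_1) ≤ (1/(1 + ε/(2n))) · 2ⁿ/n!. -/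
open MeasureTheory

lemma crossPolytope_measurable {n : ℕ} (c : Fin n → ℝ) (r : ℝ) :
    MeasurableSet (crossPolytope c r) := by
  unfold crossPolytope
  exact (isClosed_le (by fun_prop) (by fun_prop)).measurableSet

lemma crossPolytope_volume {m : ℕ} (c : Fin (m+1) → ℝ) (r : ℝ) :
    (volume (crossPolytope c r)).toReal = (max r 0) ^ (m+1) * (2 ^ (m+1) / ((m+1).factorial : ℝ)) := by
  have h0 : crossPolytope c r = (fun x => x - c) ⁻¹' {x : Fin (m+1) → ℝ | (∑ i, |x i| ^ (1:ℝ)) ^ (1/(1:ℝ)) ≤ r} := by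
    ext x
    simp [crossPolytope]
  simp only [sub_eq_add_neg] at h0
  rw [h0, measure_preimage_add_right, volume_sum_rpow_le (Fin (m+1)) (le_refl (1:ℝ)) r]
  have hG : Real.Gamma (1/1+1) = 1 := by
    norm_num
  have hG2 : Real.Gamma ((Fintype.card (Fin (m+1)) : ℝ)/1+1) = ((m+1).factorial : ℝ) := by
    rw [div_one, Real.Gamma_nat_eq_factorial, Fintype.card_fin]
  rw [hG, hG2, ENNReal.toReal_mul, ENNReal.toReal_pow, ENNReal.toReal_ofReal', ENNReal.toReal_ofReal (by positivity)]
  simp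

lemma shear_mp {m : ℕ} (g : (Fin m → ℝ) → ℝ) (hg : Measurable g) :
    MeasurePreserving (fun x : Fin (m+1) → ℝ =>
      (Fin.cons (x 0 - g (Fin.tail x)) (Fin.tail x) : Fin (m+1) → ℝ)) volume volume := by
  have e := volume_preserving_piFinSuccAbove (fun _ : Fin (m+1) => ℝ) 0
  have s1 : MeasurePreserving (Prod.swap : ℝ × (Fin m → ℝ) → _) volume volume :=
    Measure.measurePreserving_swap
  have s2 : MeasurePreserving (Prod.swap : (Fin m → ℝ) × ℝ → _) volume volume :=
    Measure.measurePreserving_swap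
  have k : MeasurePreserving (fun p : (Fin m → ℝ) × ℝ => (p.1, p.2 - g p.1)) volume volume := by
    refine MeasurePreserving.skew_product (g := fun y x => x - g y) (MeasurePreserving.id _) ?_ ?_
    · exact measurable_snd.sub (hg.comp measurable_fst)
    · exact Filter.Eventually.of_forall fun y => (measurePreserving_sub_right volume (g y)).map_eq
  have := (e.symm _).comp (s2.comp (k.comp (s1.comp e)))
  have hf : (fun x : Fin (m+1) → ℝ =>
      (Fin.cons (x 0 - g (Fin.tail x)) (Fin.tail x) : Fin (m+1) → ℝ)) =
      (MeasurableEquiv.piFinSuccAbove (fun _ : Fin (m+1) => ℝ) 0).symm ∘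
      Prod.swap ∘ (fun p : (Fin m → ℝ) × ℝ => (p.1, p.2 - g p.1)) ∘ Prod.swap ∘
        (MeasurableEquiv.piFinSuccAbove (fun _ : Fin (m+1) => ℝ) 0) := by
    funext x
    change _ = Fin.insertNth 0 _ _
    rw [Fin.insertNth_zero]
    rfl
  rw [hf]
  exact this

lemma inter_bound {m : ℕ} (c : Fin (m+1) → ℝ) (β : ℝ) :
    (volume (crossPolytope (0 : Fin (m+1) → ℝ) 1 ∩ crossPolytope c β)).toReal
      ≤ (max ((1+β-c 0)/2) 0) ^ (m+1) * (2 ^ (m+1) / ((m+1).factorial : ℝ)) := by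
  let g : (Fin m → ℝ) → ℝ := fun y =>
    ((1 - ∑ i, |y i|) + (c 0 - (β - ∑ i, |y i - c i.succ|))) / 2
  have hg : Measurable g := by
    apply Continuous.measurable
    fun_prop
  let d : Fin (m+1) → ℝ := Fin.cons 0 (fun i => c i.succ / 2)
  rw [← crossPolytope_volume d]
  rw [← (shear_mp g hg).measure_preimage (crossPolytope_measurable d _).nullMeasurableSet]
  refine ENNReal.toReal_mono ?_ (measure_mono ?_)
  · rw [(shear_mp g hg).measure_preimage (crossPolytope_measurable d _).nullMeasurableSet]
    have hb : Bornology.IsBounded (crossPolytope d ((1+β-c 0)/2)) := by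
      refine (Metric.isBounded_closedBall (x := d) (r := max ((1+β-c 0)/2) 0)).subset ?_
      intro x hx
      rw [Metric.mem_closedBall, dist_pi_le_iff (le_max_right _ _)]
      intro i
      rw [Real.dist_eq]
      refine le_trans ?_ (le_max_left _ _)
      exact le_trans (Finset.single_le_sum (f := fun i => |x i - d i|)
        (fun _ _ => abs_nonneg _) (Finset.mem_univ i)) hx
    exact hb.measure_lt_top.ne
  · rintro x ⟨h1, h2⟩
    simp only [crossPolytope, Set.mem_ofPred_eq, Fin.sum_univ_succ, Pi.zero_apply, sub_zero] at h1 h2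
    simp only [crossPolytope, Set.mem_preimage, Set.mem_ofPred_eq, Fin.sum_univ_succ, d, Fin.cons_zero, Fin.cons_succ, g, Fin.tail, sub_zero]
    have key : ∑ i : Fin m, |x i.succ - c i.succ / 2| ≤
        (∑ i : Fin m, |x i.succ| + ∑ i : Fin m, |x i.succ - c i.succ|) / 2 := by
      rw [← Finset.sum_add_distrib, Finset.sum_div]
      refine Finset.sum_le_sum fun i _ => ?_
      have := abs_add_le (x i.succ) (x i.succ - c i.succ)
      have h3 : x i.succ - c i.succ / 2 = (x i.succ + (x i.succ - c i.succ)) / 2 := by ring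
      rw [h3, abs_div, abs_two]
      linarith
    have h4 := le_abs_self (x 0)
    have h5 := neg_abs_le (x 0 - c 0)
    rw [← le_sub_iff_add_le, abs_le]
    constructor <;> linarith

theorem stmt10 (n : ℕ) (hn : 0 < n) (a : Fin n → ℤ)
    (hmono : ∀ i j : Fin n, i ≤ j → a j ≤ a i) (hnn : ∀ i, 0 ≤ a i)
    (ha1 : 1 ≤ a ⟨0, hn⟩)
    (ε β : ℝ) (hε0 : 0 < ε) (hε1 : ε < 1) (hβ0 : 0 < β) (hβ1 : β < 1)
    (hβ : ε / (n * ∑ i, |(a i : ℝ)|) ≤ 1 - β) :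
    (volume (crossPolytope (0 : Fin n → ℝ) 1 ∩
        crossPolytope ((1 - β) • fun i => (a i : ℝ)) β)).toReal
      ≤ (1 / (1 + ε / (2 * n))) * ((2 : ℝ) ^ n / (n.factorial : ℝ)) := by
  obtain ⟨m, rfl⟩ : ∃ m, n = m + 1 := ⟨n - 1, by omega⟩
  refine (inter_bound _ β).trans ?_
  refine mul_le_mul_of_nonneg_right ?_ (by positivity)
  have e0 : (⟨0, hn⟩ : Fin (m+1)) = 0 := rfl
  rw [e0] at ha1
  have hA1 : (1:ℝ) ≤ a 0 := by exact_mod_cast ha1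
  have hS : ∑ i, |(a i : ℝ)| ≤ ((m+1 : ℕ) : ℝ) * a 0 := by
    have : ∀ i ∈ Finset.univ, |(a i : ℝ)| ≤ a 0 := by
      intro i _
      rw [abs_of_nonneg (by exact_mod_cast hnn i)]
      exact_mod_cast hmono 0 i (Fin.zero_le i)
    simpa using Finset.sum_le_card_nsmul _ _ _ this
  have hS1 : (1:ℝ) ≤ ∑ i, |(a i : ℝ)| :=
    (hA1.trans (le_abs_self _)).trans (Finset.single_le_sum (f := fun i => |(a i : ℝ)|)
      (fun _ _ => abs_nonneg _) (Finset.mem_univ 0))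
  set S := ∑ i, |(a i : ℝ)|
  set N : ℝ := ((m+1 : ℕ) : ℝ) with hN
  have hNpos : 0 < N := by positivity
  have ht : 0 < 1 - β := by linarith
  have h1 : ε ≤ (1 - β) * a 0 * N * N := by
    rw [div_le_iff₀ (by positivity)] at hβ
    calc ε ≤ (1 - β) * (N * S) := hβ
      _ ≤ (1 - β) * (N * (N * a 0)) := by gcongr
      _ = _ := by ring
  have e1 : (1 + β - ((1 - β) • fun i => (a i : ℝ)) 0) / 2 = 1 - (1 - β) * (1 + a 0) / 2 := by
    simp only [Pi.smul_apply, smul_eq_mul]; ring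
  rw [e1]
  set δ := (1 - β) * (1 + a 0) / 2 with hδ
  have hδ0 : 0 < δ := by positivity
  have h2 : ε / (2 * N) ≤ N * δ := by
    rw [div_le_iff₀ (by positivity), hδ]
    have : 0 ≤ (1 - β) * N * N := by positivity
    nlinarith
  have h3 : 1 + N * δ ≤ (1 + δ) ^ (m + 1) := by
    have := one_add_mul_le_pow (a := δ) (by linarith) (m + 1)
    simpa [hN] using this
  rw [le_div_iff₀ (by positivity)]
  calc max (1 - δ) 0 ^ (m + 1) * (1 + ε / (2 * N))
      ≤ max (1 - δ) 0 ^ (m + 1) * (1 + δ) ^ (m + 1) := by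
        gcongr
        linarith
    _ = (max (1 - δ) 0 * (1 + δ)) ^ (m + 1) := by rw [mul_pow]
    _ ≤ 1 := by
        apply pow_le_one₀ (by positivity)
        rcases max_cases (1 - δ) 0 with h | h <;> rw [h.1] <;> nlinarith
end
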